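/- arXiv:2004.12422 — 2 statements merged into one kernel-verified Lean document; each statement's English description precedes it below -/
import Mathlib

section
/- Assume K = 1 and B > -1, and set p_i = 1/2 - r_i, q_i = 1 - p_i, ρ_i = q_i/p_i, π_n = ∏_{i=1}^n ρ_i, and Q_n = π_n / ((1 + Σ_{j=1}^{n-1} π_j)(1 + Σ_{j=1}^{n} π_j)). Then there exists a constant c > 0 such that Q_n ~ c / n^{B+2} as n → ∞. -/
open Filter Finset

noncomputable section

/-- Iterated logarithm: `iterLog 0 x = x`, `iterLog (k+1) x = log (iterLog k x)`. -/
def iterLog : ℕ → ℝ → ℝ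
  | 0, x => x
  | k + 1, x => Real.log (iterLog k x)

/-- Product `log_0 x · log_1 x ⋯ log_{K-1} x = x · log x ⋯ log_{K-1} x`. -/
def itLogProd (K : ℕ) (x : ℝ) : ℝ := ∏ m ∈ Finset.range K, iterLog m x

/-- `Λ(K,x,B) = 1/x + 1/(x log x) + ⋯ + 1/(x log x ⋯ log_{K-2} x)
      + B/(x log x ⋯ log_{K-1} x)`; in particular `Λ(1,x,B) = B/x`. -/
def Lam (K : ℕ) (x B : ℝ) : ℝ :=
  (∑ j ∈ Finset.Icc 1 (K - 1), (itLogProd j x)⁻¹) + B / itLogProd K x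

/-- `i₀ = min{ i : log_{K-1} i > 0 and |Λ(K,i,B)|/4 < 1/2 }`. -/
def i0 (K : ℕ) (B : ℝ) : ℕ :=
  sInf {i : ℕ | 0 < iterLog (K - 1) (i : ℝ) ∧ |Lam K (i : ℝ) B| / 4 < 1 / 2}

/-- The perturbation `r_i = Λ(K,i,B)/4` for `i ≥ i₀`, and `r_i = r_{i₀}` for `i < i₀`. -/
def rr (K : ℕ) (B : ℝ) (i : ℕ) : ℝ :=
  if i0 K B ≤ i then Lam K (i : ℝ) B / 4 else Lam K (i0 K B : ℝ) B / 4

lemma tendsto_rpow_ratio_add (k : ℕ) (B : ℝ) :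
    Tendsto (fun n : ℕ => (n : ℝ) ^ B / ((n + k : ℕ) : ℝ) ^ B) atTop (nhds 1) := by
  have h := (tendsto_natCast_div_add_atTop (𝕜 := ℝ) (k : ℝ)).rpow_const (p := B)
    (Or.inl one_ne_zero)
  rw [Real.one_rpow] at h
  refine h.congr fun n => ?_
  rw [Real.div_rpow (by positivity) (by positivity)]
  push_cast
  rfl

lemma tendsto_prod_ratio_div_rpow {s t : ℝ} (hs : 0 < s) (ht : 0 < t) :
    Tendsto (fun n : ℕ => (∏ j ∈ Finset.range (n + 1), (s + j) / (t + j)) / (n : ℝ) ^ (s - t))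
      atTop (nhds (Real.Gamma t / Real.Gamma s)) := by
  have h := (Real.GammaSeq_tendsto_Gamma t).div (Real.GammaSeq_tendsto_Gamma s)
    (Real.Gamma_pos_of_pos hs).ne'
  refine h.congr' ?_
  filter_upwards [eventually_gt_atTop 0] with n hn
  have hn' : (0 : ℝ) < n := by exact_mod_cast hn
  have h1 : (∏ j ∈ Finset.range (n + 1), (s + j)) ≠ 0 :=
    Finset.prod_ne_zero_iff.2 fun j _ => by positivity
  have h2 : (∏ j ∈ Finset.range (n + 1), (t + j)) ≠ 0 :=
    Finset.prod_ne_zero_iff.2 fun j _ => by positivity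
  have h3 : ((n.factorial : ℕ) : ℝ) ≠ 0 := by positivity
  have h4 := (Real.rpow_pos_of_pos hn' s).ne'
  have h5 := (Real.rpow_pos_of_pos hn' t).ne'
  simp only [Pi.div_apply, Real.GammaSeq]
  rw [Finset.prod_div_distrib, Real.rpow_sub hn']
  field_simp

/-- A positive sequence whose consecutive ratios are eventually `(2i + B) / (2i - B)`
grows like a multiple of `n ^ B`. -/
lemma exists_tendsto_div_rpow_of_ratio {B : ℝ} {m : ℕ} (hm : |B| < 2 * m) {u : ℕ → ℝ}
    (hu : 0 < u m) (hrec : ∀ i, m ≤ i → u (i + 1) =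
      u i * ((2 * ((i + 1 : ℕ) : ℝ) + B) / (2 * ((i + 1 : ℕ) : ℝ) - B))) :
    ∃ C : ℝ, 0 < C ∧ Tendsto (fun n : ℕ => u n / (n : ℝ) ^ B) atTop (nhds C) := by
  obtain ⟨hB1, hB2⟩ := abs_lt.1 hm
  set s : ℝ := m + 1 + B / 2 with hs
  set t : ℝ := m + 1 - B / 2 with ht
  have hs0 : 0 < s := by linarith
  have ht0 : 0 < t := by linarith
  have hst : s - t = B := by ring
  have hform : ∀ n : ℕ, u (n + m) = u m * ∏ j ∈ Finset.range n, (s + j) / (t + j) := by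
    intro n
    induction n with
    | zero => simp
    | succ n ih =>
      rw [Finset.prod_range_succ, ← mul_assoc, ← ih, show n + 1 + m = n + m + 1 by ring,
        hrec _ (by omega)]
      congr 1
      rw [show s + n = (2 * ((n + m + 1 : ℕ) : ℝ) + B) / 2 by push_cast; rw [hs]; ring,
        show t + n = (2 * ((n + m + 1 : ℕ) : ℝ) - B) / 2 by push_cast; rw [ht]; ring,
        div_div_div_cancel_right₀ two_ne_zero]
  refine ⟨u m * (Real.Gamma t / Real.Gamma s) * 1,
    by have := Real.Gamma_pos_of_pos hs0; have := Real.Gamma_pos_of_pos ht0; positivity, ?_⟩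
  rw [← tendsto_add_atTop_iff_nat (m + 1)]
  refine (((tendsto_prod_ratio_div_rpow hs0 ht0).const_mul (u m)).mul
    (tendsto_rpow_ratio_add (m + 1) B)).congr' ?_
  filter_upwards [eventually_gt_atTop 0] with n hn
  have hn' : (0 : ℝ) < n := by exact_mod_cast hn
  have h4 := (Real.rpow_pos_of_pos hn' B).ne'
  rw [hst, show n + (m + 1) = n + 1 + m by ring, hform]
  field_simp

lemma sum_Icc_of_ratio {B : ℝ} {m : ℕ} (hm : |B| < 2 * m) (hB : -1 < B) {u : ℕ → ℝ}
    (hrec : ∀ i, m ≤ i → u (i + 1) =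
      u i * ((2 * ((i + 1 : ℕ) : ℝ) + B) / (2 * ((i + 1 : ℕ) : ℝ) - B))) :
    ∃ D : ℝ, ∀ n, m ≤ n → 1 + ∑ j ∈ Finset.Icc 1 n, u j =
      D + (2 * n + 2 + B) * u n / (2 * B + 2) := by
  refine ⟨1 + ∑ j ∈ Finset.Icc 1 m, u j - (2 * m + 2 + B) * u m / (2 * B + 2), ?_⟩
  intro n hn
  induction n, hn using Nat.le_induction with
  | base => ring
  | succ n hn ih =>
    rw [Finset.sum_Icc_succ_top (by omega), ← add_assoc, ih, hrec n hn]
    have hn' : (m : ℝ) ≤ n := by exact_mod_cast hn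
    have h1 : (2 * ((n : ℝ) + 1) - B) ≠ 0 := by
      have := (abs_lt.1 hm).2
      linarith
    have h2 : B + 1 ≠ 0 := by linarith
    rw [show 2 * B + 2 = 2 * (B + 1) by ring]
    push_cast
    field_simp
    ring

lemma i0_one_spec (B : ℝ) : 0 < i0 1 B ∧ |B| < 2 * i0 1 B := by
  have hne : {i : ℕ | 0 < iterLog (1 - 1) (i : ℝ) ∧
      |Lam 1 (i : ℝ) B| / 4 < 1 / 2}.Nonempty := by
    obtain ⟨i, hi⟩ := exists_nat_gt |B|
    have hi0 : (0 : ℝ) < i := (abs_nonneg B).trans_lt hi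
    refine ⟨i, by simpa [iterLog] using hi0, ?_⟩
    have : |B| / i < 1 := (div_lt_one hi0).2 hi
    simp only [Lam, itLogProd, iterLog, abs_div, abs_of_pos hi0, Nat.sub_self,
      Finset.prod_range_one, zero_lt_one, Finset.Icc_eq_empty_of_lt, Finset.sum_empty, zero_add]
    linarith
  obtain ⟨h1, h2⟩ := Nat.sInf_mem hne
  change 0 < iterLog (1 - 1) (i0 1 B : ℝ) at h1
  change |Lam 1 (i0 1 B : ℝ) B| / 4 < 1 / 2 at h2
  simp only [iterLog, Nat.sub_self] at h1
  simp only [Lam, itLogProd, iterLog, abs_div, abs_of_pos h1, Nat.sub_self,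
    Finset.prod_range_one, zero_lt_one, Finset.Icc_eq_empty_of_lt, Finset.sum_empty,
    zero_add] at h2
  refine ⟨by exact_mod_cast h1, ?_⟩
  have : |B| / (i0 1 B : ℝ) < 2 := by linarith
  exact (div_lt_iff₀ h1).1 this

lemma rr_one (B : ℝ) (i : ℕ) : rr 1 B i = B / (max i (i0 1 B) : ℕ) / 4 := by
  unfold rr
  split_ifs with h
  · simp [Lam, itLogProd, iterLog, max_eq_left h]
  · simp [Lam, itLogProd, iterLog, max_eq_right (not_le.1 h).le]

/-- case `K = 1`, `B > -1`, `p_i = 1/2 - r_i`: `Q_n ~ c / n^{B+2}`. -/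
theorem stmt10 (K : ℕ) (hK : K = 1) (B : ℝ) (hB : -1 < B)
    (p q ρ π Q : ℕ → ℝ)
    (hp : ∀ i : ℕ, 1 ≤ i → p i = 1 / 2 - rr K B i)
    (hq : ∀ i : ℕ, q i = 1 - p i)
    (hρ : ∀ i : ℕ, ρ i = q i / p i)
    (hπ : ∀ n : ℕ, π n = ∏ i ∈ Finset.Icc 1 n, ρ i)
    (hQ : ∀ n : ℕ, Q n = π n /
      ((1 + ∑ j ∈ Finset.Icc 1 (n - 1), π j) * (1 + ∑ j ∈ Finset.Icc 1 n, π j))) :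
    ∃ c : ℝ, 0 < c ∧ Tendsto
      (fun n : ℕ => Q n * (n : ℝ) ^ (B + 2))
      atTop (nhds c) := by
  subst hK
  obtain ⟨hm0, hm⟩ := i0_one_spec B
  set m := i0 1 B with hmdef
  have hρ' : ∀ i, 1 ≤ i → ρ i = (2 * ((max i m : ℕ) : ℝ) + B) / (2 * ((max i m : ℕ) : ℝ) - B) ∧
      0 < ρ i := by
    intro i hi
    have hM : (m : ℝ) ≤ (max i m : ℕ) := by exact_mod_cast le_max_right i m
    obtain ⟨h1, h2⟩ := abs_lt.1 hm
    have hp' := hp i hi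
    rw [rr_one, ← hmdef] at hp'
    generalize ((max i m : ℕ) : ℝ) = M at hM hp'
    have hM0 : 0 < M := by
      have : (0 : ℝ) < m := by exact_mod_cast hm0
      linarith
    have h3 : 0 < 2 * M - B := by linarith
    have h4 : 0 < 2 * M + B := by linarith
    have hpe : p i = (2 * M - B) / (4 * M) := by rw [hp']; field_simp; ring
    have hqe : q i = (2 * M + B) / (4 * M) := by rw [hq, hpe]; field_simp; ring
    have : ρ i = (2 * M + B) / (2 * M - B) := by
      rw [hρ, hpe, hqe, div_div_div_cancel_right₀ (by positivity)]
    exact ⟨this, this ▸ div_pos h4 h3⟩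
  have hrec : ∀ i, m ≤ i → π (i + 1) =
      π i * ((2 * ((i + 1 : ℕ) : ℝ) + B) / (2 * ((i + 1 : ℕ) : ℝ) - B)) := by
    intro i hi
    rw [hπ, hπ, Finset.prod_Icc_succ_top (by omega), (hρ' (i + 1) (by omega)).1,
      max_eq_left (by omega : m ≤ i + 1)]
  have hπm : 0 < π m := by
    rw [hπ]
    exact Finset.prod_pos fun i hi => (hρ' i (Finset.mem_Icc.1 hi).1).2
  obtain ⟨C, hC, hlim⟩ := exists_tendsto_div_rpow_of_ratio hm hπm hrec
  obtain ⟨D, hD⟩ := sum_Icc_of_ratio hm hB hrec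
  have hB1 : 0 < B + 1 := by linarith
  have hinv : Tendsto (fun n : ℕ => ((n : ℝ))⁻¹) atTop (nhds 0) :=
    tendsto_inv_atTop_zero.comp tendsto_natCast_atTop_atTop
  have hpow : Tendsto (fun n : ℕ => ((n : ℝ) ^ (B + 1))⁻¹) atTop (nhds 0) :=
    tendsto_inv_atTop_zero.comp ((tendsto_rpow_atTop hB1).comp tendsto_natCast_atTop_atTop)
  have hS : Tendsto (fun n : ℕ => (1 + ∑ j ∈ Finset.Icc 1 n, π j) / (n : ℝ) ^ (B + 1))
      atTop (nhds (C / (B + 1))) := by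
    have h := (hpow.const_mul D).add
      (((hinv.const_mul (2 + B)).const_add 2).mul (hlim.div_const (2 * B + 2)))
    rw [show D * 0 + (2 + (2 + B) * 0) * (C / (2 * B + 2)) = C / (B + 1) by
      rw [show 2 * B + 2 = 2 * (B + 1) by ring]; field_simp; ring] at h
    refine h.congr' ?_
    filter_upwards [eventually_ge_atTop m, eventually_gt_atTop 0] with n hn hn0
    have hn' : (0 : ℝ) < n := by exact_mod_cast hn0
    have h4 := (Real.rpow_pos_of_pos hn' B).ne'
    have h2 : B + 1 ≠ 0 := by linarith
    rw [hD n hn, Real.rpow_add_one hn'.ne', show 2 * B + 2 = 2 * (B + 1) by ring]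
    field_simp
    ring
  have hS' : Tendsto (fun n : ℕ => (1 + ∑ j ∈ Finset.Icc 1 (n - 1), π j) / (n : ℝ) ^ (B + 1))
      atTop (nhds (C / (B + 1))) := by
    have h := hS.sub (hlim.mul hinv)
    rw [mul_zero, sub_zero] at h
    refine h.congr' ?_
    filter_upwards [eventually_gt_atTop 0] with n hn0
    obtain ⟨k, rfl⟩ : ∃ k, n = k + 1 := ⟨n - 1, by omega⟩
    have hn' : (0 : ℝ) < (k + 1 : ℕ) := by positivity
    rw [Finset.sum_Icc_succ_top (by omega), Real.rpow_add_one hn'.ne', Nat.add_sub_cancel]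
    have h4 := (Real.rpow_pos_of_pos hn' B).ne'
    field_simp
    ring
  refine ⟨C / (C / (B + 1) * (C / (B + 1))), by positivity, ?_⟩
  refine (hlim.div (hS'.mul hS) (by positivity)).congr' ?_
  filter_upwards [eventually_gt_atTop 0] with n hn0
  have hn' : (0 : ℝ) < n := by exact_mod_cast hn0
  have h4 := (Real.rpow_pos_of_pos hn' B).ne'
  simp only [Pi.div_apply]
  rw [hQ, show B + 2 = B + 1 + 1 by ring, Real.rpow_add_one hn'.ne' (B + 1),
    Real.rpow_add_one hn'.ne' B, div_mul_div_comm, div_div_div_eq, div_mul_eq_mul_div,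
    ← mul_div_mul_left (π n * ((n : ℝ) ^ B * n * n)) _ h4]
  congr 1
  ring
end
end

section
/- Assume K = 1 and B = -1, and set p_i = 1/2 - r_i, q_i = 1 - p_i, ρ_i = q_i/p_i, π_n = ∏_{i=1}^n ρ_i, and Q_n = π_n / ((1 + Σ_{j=1}^{n-1} π_j)(1 + Σ_{j=1}^{n} π_j)). Then there exists a constant c > 0 such that Q_n ~ c / (n (log n)²) as n → ∞. -/
open Filter Finset

noncomputable section

lemma rr_one_neg_one {i : ℕ} (hi : 1 ≤ i) : rr 1 (-1) i = -1 / i / 4 := by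
  have h0 : i0 1 (-1) = 1 := by
    unfold i0
    refine le_antisymm (Nat.sInf_le ?_) ?_
    · norm_num [iterLog, Lam, itLogProd]
    · refine le_csInf ⟨1, ?_⟩ ?_
      · norm_num [iterLog, Lam, itLogProd]
      · rintro j ⟨hj, -⟩
        have hj' : (0 : ℝ) < j := by simpa [iterLog] using hj
        exact Nat.succ_le_of_lt (by exact_mod_cast hj')
  simp [rr, h0, hi, Lam, itLogProd, iterLog]

/-- The product of the telescoping ratios `(2i-1)/(2i+1)`. -/
lemma prod_Icc_odd_ratio (n : ℕ) :
    ∏ i ∈ Finset.Icc 1 n, ((2 * i - 1) / (2 * i + 1) : ℝ) = 1 / (2 * n + 1) := by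
  induction n with
  | zero => simp
  | succ n ih =>
    rw [Finset.prod_Icc_succ_top (by omega), ih]
    push_cast
    have h : (2 * n + 1 : ℝ) ≠ 0 := by positivity
    have h' : (2 * (n + 1) + 1 : ℝ) ≠ 0 := by positivity
    field_simp
    ring

lemma half_harmonic_le_sum_odd (n : ℕ) :
    (harmonic n : ℝ) / 2 ≤ 1 + ∑ j ∈ Finset.Icc 1 n, (1 / (2 * j + 1) : ℝ) - 1 / (2 * (n + 1)) := by
  induction n with
  | zero => norm_num
  | succ n ih =>
    rw [Finset.sum_Icc_succ_top (by omega), harmonic_succ]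
    push_cast
    have h : (1 / (2 * ((n : ℝ) + 1 + 1)) : ℝ) ≤ 1 / (2 * (n + 1) + 1) :=
      one_div_le_one_div_of_le (by positivity) (by linarith)
    have h' : ((n : ℝ) + 1)⁻¹ / 2 = 1 / (2 * (n + 1)) := by field_simp
    linarith

lemma sum_odd_le_half_harmonic (n : ℕ) :
    1 + ∑ j ∈ Finset.Icc 1 n, (1 / (2 * j + 1) : ℝ) ≤ 1 + (harmonic n : ℝ) / 2 := by
  induction n with
  | zero => norm_num
  | succ n ih =>
    rw [Finset.sum_Icc_succ_top (by omega), harmonic_succ]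
    push_cast
    have h : (1 / (2 * ((n : ℝ) + 1) + 1) : ℝ) ≤ 1 / (2 * (n + 1)) :=
      one_div_le_one_div_of_le (by positivity) (by linarith)
    have h' : ((n : ℝ) + 1)⁻¹ / 2 = 1 / (2 * (n + 1)) := by field_simp
    linarith

lemma tendsto_log_natCast_atTop : Tendsto (fun n : ℕ => Real.log n) atTop atTop :=
  Real.tendsto_log_atTop.comp tendsto_natCast_atTop_atTop

lemma tendsto_sum_odd_div_log :
    Tendsto (fun n : ℕ => (1 + ∑ j ∈ Finset.Icc 1 n, (1 / (2 * j + 1) : ℝ)) / Real.log n)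
      atTop (nhds (1 / 2)) := by
  have hup : Tendsto (fun n : ℕ => 3 / 2 / Real.log n + 1 / 2) atTop (nhds (1 / 2)) := by
    have h := (tendsto_log_natCast_atTop.const_div_atTop (3 / 2)).add_const (1 / 2 : ℝ)
    rwa [zero_add] at h
  refine tendsto_of_tendsto_of_tendsto_of_le_of_le' tendsto_const_nhds hup ?_ ?_ <;>
    filter_upwards [tendsto_log_natCast_atTop.eventually_gt_atTop 0, eventually_ge_atTop 1]
      with n hn hn1
  · rw [le_div_iff₀ hn]
    have h1 := half_harmonic_le_sum_odd n
    have h2 := log_add_one_le_harmonic n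
    have h3 : Real.log n ≤ Real.log (n + 1 : ℕ) :=
      Real.log_le_log (by exact_mod_cast hn1) (by push_cast; linarith)
    have h4 : (0 : ℝ) ≤ 1 / (2 * (n + 1)) := by positivity
    linarith
  · have h1 := sum_odd_le_half_harmonic n
    have h2 := harmonic_le_one_add_log n
    rw [div_add' _ _ _ hn.ne']
    exact div_le_div_of_nonneg_right (by linarith) hn.le

lemma tendsto_sum_odd_pred_div_log :
    Tendsto (fun n : ℕ => (1 + ∑ j ∈ Finset.Icc 1 (n - 1), (1 / (2 * j + 1) : ℝ)) / Real.log n)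
      atTop (nhds (1 / 2)) := by
  have h1 : Tendsto (fun n : ℕ => (1 / (2 * n + 1) : ℝ)) atTop (nhds 0) :=
    (tendsto_atTop_add_const_right _ _
      (tendsto_natCast_atTop_atTop.const_mul_atTop two_pos)).const_div_atTop 1
  have h2 := tendsto_sum_odd_div_log.sub (h1.div_atTop tendsto_log_natCast_atTop)
  rw [sub_zero] at h2
  refine h2.congr' ?_
  filter_upwards [eventually_ge_atTop 1] with n hn
  obtain ⟨m, rfl⟩ := Nat.exists_eq_add_of_le' hn
  rw [Finset.sum_Icc_succ_top (by omega), Nat.add_sub_cancel]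
  ring

/-- case `K = 1`, `B = -1`, `p_i = 1/2 - r_i`: `Q_n ~ c / (n (log n)²)`. -/
theorem stmt11 (K : ℕ) (hK : K = 1) (B : ℝ) (hB : B = -1)
    (p q ρ π Q : ℕ → ℝ)
    (hp : ∀ i : ℕ, 1 ≤ i → p i = 1 / 2 - rr K B i)
    (hq : ∀ i : ℕ, q i = 1 - p i)
    (hρ : ∀ i : ℕ, ρ i = q i / p i)
    (hπ : ∀ n : ℕ, π n = ∏ i ∈ Finset.Icc 1 n, ρ i)
    (hQ : ∀ n : ℕ, Q n = π n /
      ((1 + ∑ j ∈ Finset.Icc 1 (n - 1), π j) * (1 + ∑ j ∈ Finset.Icc 1 n, π j))) :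
    ∃ c : ℝ, 0 < c ∧ Tendsto
      (fun n : ℕ => Q n * ((n : ℝ) * Real.log (n : ℝ) ^ 2))
      atTop (nhds c) := by
  subst hK hB
  have hρ' : ∀ i : ℕ, 1 ≤ i → ρ i = (2 * i - 1) / (2 * i + 1) := by
    intro i hi
    have hi' : (0 : ℝ) < i := by exact_mod_cast hi
    have hp' : p i = (2 * i + 1) / (4 * i) := by
      rw [hp i hi, rr_one_neg_one hi]
      field_simp
      ring
    rw [hρ, hq, hp']
    field_simp
    ring
  have hπ' : ∀ n : ℕ, π n = 1 / (2 * n + 1) := by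
    intro n
    rw [hπ, ← prod_Icc_odd_ratio]
    exact Finset.prod_congr rfl fun i hi => hρ' i (Finset.mem_Icc.1 hi).1
  have hnπ : Tendsto (fun n : ℕ => (n : ℝ) / (2 * n + 1)) atTop (nhds (1 / 2)) := by
    have h : Tendsto (fun n : ℕ => (1 / (2 + 1 / n) : ℝ)) atTop (nhds (1 / (2 + 0))) :=
      tendsto_const_nhds.div
        (tendsto_const_nhds.add (tendsto_natCast_atTop_atTop.const_div_atTop 1)) (by norm_num)
    rw [add_zero] at h
    refine h.congr' ?_
    filter_upwards [eventually_ge_atTop 1] with n hn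
    have hn' : (0 : ℝ) < n := by exact_mod_cast hn
    field_simp
  refine ⟨2, two_pos, ?_⟩
  have h := hnπ.div (tendsto_sum_odd_pred_div_log.mul tendsto_sum_odd_div_log)
    (by norm_num : (1 / 2 * (1 / 2) : ℝ) ≠ 0)
  rw [show (1 / 2 / (1 / 2 * (1 / 2)) : ℝ) = 2 by norm_num] at h
  refine h.congr' ?_
  filter_upwards [tendsto_log_natCast_atTop.eventually_gt_atTop 0] with n hn
  simp only [hQ, hπ', Pi.div_apply]
  have hpos : ∀ m : ℕ, 0 < 1 + ∑ j ∈ Finset.Icc 1 m, (1 / (2 * j + 1) : ℝ) := fun m => by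
    positivity
  have h1 := hpos n
  have h2 := hpos (n - 1)
  generalize 1 + ∑ j ∈ Finset.Icc 1 n, (1 / (2 * j + 1) : ℝ) = S at *
  generalize 1 + ∑ j ∈ Finset.Icc 1 (n - 1), (1 / (2 * j + 1) : ℝ) = T at *
  have hn2 : (0 : ℝ) < 2 * n + 1 := by positivity
  field_simp
end
end
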